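/- Every element of R_L is orthogonal to every element of R_A with respect to the bilinear form on V ⊗ V; that is, R_L ⊆ R_A^⊥. (This expresses that the pairing between the quadratic components of the generalized Orlik–Solomon algebra 𝒜^k_d(n) and the universal envelope of the generalized Drinfeld–Kohno Lie algebra 𝔱^k_d(n) is well defined: the quadratic relations of each side pair to zero with arbitrary quadratic monomials of the other side.) -/

import Mathlib

/-- Index set for the generators: `(k+1)`-element subsets of `{1,…,n}`. -/
abbrev OSGen (k n : ℕ) := {S : Finset (Fin n) // S.card = k + 1}

/-- The space `V ⊗ V`, where `V` is the `ℚ`-vector space with basis `(e_S)_{S ∈ B(k,n)}`: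
it is modelled as the space of `ℚ`-valued functions on pairs `(S,T)`, so that the tensors
`e_S ⊗ e_T` form a basis. -/
abbrev TensorSq (k n : ℕ) := OSGen k n × OSGen k n → ℚ

/-- The basis tensor `e_S ⊗ e_T` of `V ⊗ V`. -/
def eTensor (k n : ℕ) (S T : OSGen k n) : TensorSq k n :=
  fun p => if p = (S, T) then 1 else 0

/-- The symmetric bilinear form on `V ⊗ V` for which the tensors `e_S ⊗ e_T` form an
orthonormal basis. -/
def bform (k n : ℕ) (f g : TensorSq k n) : ℚ := ∑ p, f p * g p

/-- The degree-2 relations of the (even) generalized Orlik–Solomon algebra `𝒜^k(n)`: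
(i) `e_S ⊗ e_T + e_T ⊗ e_S`; (ii) `e_S ⊗ e_T` for `|S ∩ T| ≥ 2`; (iii) the cyclic sums
`∑_{m} e_{i({m,…,m+k})} ⊗ e_{i({m+k,…,m+2k})}` for injective `i : ℤ/(2k+1) → {1,…,n}`. -/
def RAset (k n : ℕ) : Set (TensorSq k n) :=
  { x | (∃ S T, x = eTensor k n S T + eTensor k n T S) ∨
        (∃ S T, 2 ≤ (S.1 ∩ T.1).card ∧ x = eTensor k n S T) ∨
        (∃ i : ZMod (2 * k + 1) → Fin n, Function.Injective i ∧
          ∃ A : ZMod (2 * k + 1) → OSGen k n,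
            (∀ m : ZMod (2 * k + 1),
              (A m).1 = (Finset.range (k + 1)).image
                fun j : ℕ => i (m + (j : ZMod (2 * k + 1)))) ∧
            x = ∑ m : ZMod (2 * k + 1),
                  eTensor k n (A m) (A (m + (k : ZMod (2 * k + 1))))) }

/-- The relation space `R_A ⊆ V ⊗ V` of the generalized Orlik–Solomon algebra. -/
def RA (k n : ℕ) : Submodule ℚ (TensorSq k n) := Submodule.span ℚ (RAset k n)

/-- The relations of the (even) generalized Drinfeld–Kohno Lie algebra `𝔱^k(n)`:
(a) `e_S ⊗ e_T − e_T ⊗ e_S` for `S ∩ T = ∅`;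
(b) `∑_{s ∈ I} (e_I ⊗ e_{(J∖{t})∪{s}} − e_{(J∖{t})∪{s}} ⊗ e_I)` for `I ∩ J = {t}`. -/
def RLset (k n : ℕ) : Set (TensorSq k n) :=
  { x | (∃ S T, Disjoint S.1 T.1 ∧ x = eTensor k n S T - eTensor k n T S) ∨
        (∃ (I J : OSGen k n) (t : Fin n), I.1 ∩ J.1 = {t} ∧
          ∃ K : {s // s ∈ I.1} → OSGen k n,
            (∀ s, (K s).1 = insert s.1 (J.1.erase t)) ∧
            x = ∑ s : {s // s ∈ I.1},
                  (eTensor k n I (K s) - eTensor k n (K s) I)) }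

/-- The relation space `R_L ⊆ V ⊗ V` of the generalized Drinfeld–Kohno Lie algebra. -/
def RL (k n : ℕ) : Submodule ℚ (TensorSq k n) := Submodule.span ℚ (RLset k n)

theorem bform_eTensor {k n : ℕ} (f : TensorSq k n) (S T : OSGen k n) :
    bform k n f (eTensor k n S T) = f (S, T) := by
  simp [bform, eTensor]

theorem bform_comm {k n : ℕ} (f g : TensorSq k n) : bform k n f g = bform k n g f := by
  simp only [bform, mul_comm]

theorem bform_add_right {k n : ℕ} (f g h : TensorSq k n) :
    bform k n f (g + h) = bform k n f g + bform k n f h := by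
  simp [bform, mul_add, Finset.sum_add_distrib]

theorem bform_smul_right {k n : ℕ} (c : ℚ) (f g : TensorSq k n) :
    bform k n f (c • g) = c * bform k n f g := by
  simp only [bform, Pi.smul_apply, smul_eq_mul, Finset.mul_sum]
  exact Finset.sum_congr rfl fun _ _ => by ring

theorem bform_sum_right {k n : ℕ} {ι : Type*} (s : Finset ι) (f : TensorSq k n)
    (g : ι → TensorSq k n) :
    bform k n f (∑ i ∈ s, g i) = ∑ i ∈ s, bform k n f (g i) := by
  simp only [bform, Finset.sum_apply, Finset.mul_sum]
  exact Finset.sum_comm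

/-- A vector orthogonal to a set is orthogonal to its span. -/
theorem bform_eq_zero_of_mem_span {k n : ℕ} {s : Set (TensorSq k n)} {f : TensorSq k n}
    (h : ∀ g ∈ s, bform k n f g = 0) {g : TensorSq k n} (hg : g ∈ Submodule.span ℚ s) :
    bform k n f g = 0 := by
  induction hg using Submodule.span_induction with
  | mem g hg => exact h g hg
  | zero => simp [bform]
  | add g g' _ _ ih ih' => rw [bform_add_right, ih, ih', add_zero]
  | smul c g _ ih => rw [bform_smul_right, ih, mul_zero]

/-- For `C` and `D` disjoint from `I` and `a, s ∈ I`, the sets `C ∪ {a}` and `D ∪ {s}` agree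
only if `a = s` and `C = D`. -/
theorem insert_eq_insert_iff_of_disjoint {α : Type*} [DecidableEq α] {I C D : Finset α} {a s : α}
    (hC : Disjoint I C) (hD : Disjoint I D) (ha : a ∈ I) (hs : s ∈ I) :
    insert a C = insert s D ↔ s = a ∧ C = D := by
  refine ⟨fun h => ?_, fun ⟨h, h'⟩ => by rw [h, h']⟩
  have haC : a ∉ C := Finset.disjoint_left.mp hC ha
  have hsD : s ∉ D := Finset.disjoint_left.mp hD hs
  have haD : a ∉ D := Finset.disjoint_left.mp hD ha
  have hsa : s = a := by
    have : a ∈ insert s D := h ▸ Finset.mem_insert_self a C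
    exact ((Finset.mem_insert.mp this).resolve_right haD).symm
  subst hsa
  refine ⟨rfl, ?_⟩
  rw [← Finset.erase_insert haC, h, Finset.erase_insert hsD]

/-- The number of `s ∈ I` for which `C ∪ {a} = D ∪ {s}` does not depend on `a ∈ I`. -/
theorem sum_ite_insert_eq_insert {α : Type*} [DecidableEq α] {I C D : Finset α} {a : α}
    (hC : Disjoint I C) (hD : Disjoint I D) (ha : a ∈ I) :
    (∑ s : {s // s ∈ I}, if insert a C = insert s.1 D then (1 : ℚ) else 0) =
      if C = D then 1 else 0 := by
  rw [Finset.sum_eq_single ⟨a, ha⟩]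
  · simp only [insert_eq_insert_iff_of_disjoint hC hD ha ha, true_and]
  · intro s _ hs
    rw [if_neg]
    rw [insert_eq_insert_iff_of_disjoint hC hD ha s.2]
    exact fun h => hs (Subtype.ext h.1)
  · simp

theorem RLset_apply_swap {k n : ℕ} {x : TensorSq k n} (hx : x ∈ RLset k n) (S T : OSGen k n) :
    x (T, S) = -x (S, T) := by
  have key (U W : OSGen k n) : (eTensor k n U W - eTensor k n W U) (T, S) =
      -(eTensor k n U W - eTensor k n W U) (S, T) := by
    simp [eTensor, and_comm]
  rcases hx with ⟨U, W, -, rfl⟩ | ⟨I, J, t, -, K, -, rfl⟩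
  · exact key U W
  · simp only [Finset.sum_apply, key, Finset.sum_neg_distrib]

/-- In the Drinfeld–Kohno relations only monomials `e_S ⊗ e_T` with `|S ∩ T| ≤ 1` occur. -/
theorem RLset_apply_eq_zero {k n : ℕ} {x : TensorSq k n} (hx : x ∈ RLset k n) {S T : OSGen k n}
    (h : 2 ≤ (S.1 ∩ T.1).card) : x (S, T) = 0 := by
  have key (U W : OSGen k n) (hUW : (U.1 ∩ W.1).card ≤ 1) :
      (eTensor k n U W - eTensor k n W U) (S, T) = 0 := by
    have h₁ : ¬(S = U ∧ T = W) := by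
      rintro ⟨rfl, rfl⟩
      omega
    have h₂ : ¬(S = W ∧ T = U) := by
      rintro ⟨rfl, rfl⟩
      rw [Finset.inter_comm] at h
      omega
    simp [eTensor, h₁, h₂]
  rcases hx with ⟨U, W, hUW, rfl⟩ | ⟨I, J, t, hIJ, K, hK, rfl⟩
  · refine key U W ?_
    simp [Finset.disjoint_iff_inter_eq_empty.mp hUW]
  · rw [Finset.sum_apply]
    refine Finset.sum_eq_zero fun s _ => key I (K s) ?_
    rw [hK s, Finset.inter_insert_of_mem s.2, Finset.inter_erase, hIJ]
    simp

/-- The sum of the coefficients of a Drinfeld–Kohno relation over the monomials of a cyclic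
Orlik–Solomon relation vanishes. -/
theorem sum_RLset_apply_cyclic {k n : ℕ} {x : TensorSq k n} (hx : x ∈ RLset k n)
    {i : ZMod (2 * k + 1) → Fin n} (hi : Function.Injective i)
    {A : ZMod (2 * k + 1) → OSGen k n}
    (hA : ∀ m : ZMod (2 * k + 1), (A m).1 = (Finset.range (k + 1)).image
      fun j : ℕ => i (m + (j : ZMod (2 * k + 1)))) :
    ∑ m : ZMod (2 * k + 1), x (A m, A (m + (k : ZMod (2 * k + 1)))) = 0 := by
  have mem_left (m : ZMod (2 * k + 1)) : i m ∈ (A m).1 := by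
    rw [hA]
    exact Finset.mem_image.mpr ⟨0, by simp, by simp⟩
  have mem_right (m : ZMod (2 * k + 1)) : i (m + k) ∈ (A m).1 := by
    rw [hA]
    exact Finset.mem_image.mpr ⟨k, by simp, rfl⟩
  rcases hx with ⟨U, W, hUW, rfl⟩ | ⟨I, J, t, hIJ, K, hK, rfl⟩
  · refine Finset.sum_eq_zero fun m _ => ?_
    have hm : ¬Disjoint (A m).1 (A (m + k)).1 :=
      Finset.not_disjoint_iff.mpr ⟨_, mem_right m, mem_left _⟩
    have h₁ : ¬(A m = U ∧ A (m + k) = W) := by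
      rintro ⟨h, h'⟩
      exact hm (h ▸ h' ▸ hUW)
    have h₂ : ¬(A m = W ∧ A (m + k) = U) := by
      rintro ⟨h, h'⟩
      exact hm (h ▸ h' ▸ hUW.symm)
    simp [eTensor, h₁, h₂]
  have hcast : (k : ZMod (2 * k + 1)) + 1 + k = 0 := by
    have := ZMod.natCast_self (2 * k + 1)
    push_cast at this
    linear_combination this
  have hD : Disjoint I.1 (J.1.erase t) := by
    rw [Finset.disjoint_iff_inter_eq_empty, Finset.inter_erase, hIJ]
    simp
  have key (m : ZMod (2 * k + 1)) (hm : A m = I) :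
      (∑ s, if A (m + k) = K s then (1 : ℚ) else 0) =
        ∑ s, if A (m + (k + 1)) = K s then (1 : ℚ) else 0 := by
    set C : Finset (Fin n) := (Finset.range k).image
      fun j : ℕ => i (m + (k + 1) + (j : ZMod (2 * k + 1))) with hC
    have hAk : (A (m + k)).1 = insert (i (m + k)) C := by
      rw [hA, Finset.range_add_one', Finset.image_insert, Finset.map_eq_image, Finset.image_image, hC]
      congr 1
      · simp
      · refine Finset.image_congr fun j _ => ?_
        change i (m + k + ((j + 1 : ℕ) : ZMod (2 * k + 1))) = _
        push_cast
        congr 1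
        ring
    have hAk' : (A (m + (k + 1))).1 = insert (i m) C := by
      rw [hA, Finset.range_add_one, Finset.image_insert, hC]
      congr 2
      linear_combination hcast
    have hIC : Disjoint I.1 C := by
      rw [← hm, hA, hC, Finset.disjoint_left]
      simp only [Finset.mem_image, Finset.mem_range]
      rintro _ ⟨j, hj, rfl⟩ ⟨l, hl, h⟩
      have h' : ((k + 1 + l : ℕ) : ZMod (2 * k + 1)) = (j : ℕ) := by
        push_cast
        linear_combination hi h
      rw [ZMod.natCast_eq_natCast_iff', Nat.mod_eq_of_lt (by omega),
        Nat.mod_eq_of_lt (by omega)] at h'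
      omega
    simp only [Subtype.ext_iff, hK, hAk, hAk']
    rw [sum_ite_insert_eq_insert hIC hD (hm ▸ mem_right m),
      sum_ite_insert_eq_insert hIC hD (hm ▸ mem_left m)]
  simp only [Finset.sum_apply, Pi.sub_apply, Finset.sum_sub_distrib, sub_eq_zero]
  rw [← Equiv.sum_comp (Equiv.addRight ((k : ZMod (2 * k + 1)) + 1))
    fun m => ∑ s, eTensor k n (K s) I (A m, A (m + k))]
  refine Finset.sum_congr rfl fun m _ => ?_
  have hm' : m + ((k : ZMod (2 * k + 1)) + 1) + k = m := by linear_combination hcast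
  simp only [Equiv.coe_addRight, hm', eTensor, Prod.mk.injEq]
  by_cases hm : A m = I
  · simpa only [hm, true_and, and_true] using key m hm
  · simp [hm]

theorem bform_RLset_RAset {k n : ℕ} {x y : TensorSq k n} (hx : x ∈ RLset k n)
    (hy : y ∈ RAset k n) : bform k n x y = 0 := by
  rcases hy with ⟨S, T, rfl⟩ | ⟨S, T, h, rfl⟩ | ⟨i, hi, A, hA, rfl⟩
  · rw [bform_add_right, bform_eTensor, bform_eTensor, RLset_apply_swap hx, neg_add_cancel]
  · rw [bform_eTensor, RLset_apply_eq_zero hx h]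
  · simp only [bform_sum_right, bform_eTensor]
    exact sum_RLset_apply_cyclic hx hi hA

/-- Every element of `R_L` is orthogonal to every element of `R_A` with
respect to the bilinear form on `V ⊗ V`; that is, `R_L ⊆ R_A^⊥`. -/
theorem RL_subset_RA_orthogonal (k n : ℕ) (hk : 1 ≤ k) (hn : 1 ≤ n) :
    ∀ x ∈ RL k n, ∀ y ∈ RA k n, bform k n x y = 0 := by
  intro x hx y hy
  refine bform_eq_zero_of_mem_span (fun y hy => ?_) hy
  rw [bform_comm]
  refine bform_eq_zero_of_mem_span (fun x hx => ?_) hx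
  rw [bform_comm]
  exact bform_RLset_RAset hx hy
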